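/- Fix d ≥ 1, let H be any d×d Hadamard matrix (entries in {−1,+1} with H·Hᵀ = d·I), and let D be a random diagonal matrix with i.i.d. Rademacher diagonal entries. Then for every x ∈ ℝ^d and every coordinate i, the randomized Hadamard transform R_H x = (1/√d)·H·D·x satisfies (1/√(2d))·‖x‖₂ ≤ E[|(R_H x)_i|] ≤ (1/√d)·‖x‖₂. -/

import Mathlib

open Matrix MeasureTheory BigOperators
open scoped ENNReal

/-- The Rademacher distribution on `ℝ`: `±1` each with probability `1/2`. -/
noncomputable def radMeasure : Measure ℝ :=
  (2 : ℝ≥0∞)⁻¹ • Measure.dirac 1 + (2 : ℝ≥0∞)⁻¹ • Measure.dirac (-1)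

/-- The law of `d` i.i.d. Rademacher random variables. -/
noncomputable def radPi (d : ℕ) : Measure (Fin d → ℝ) :=
  Measure.pi fun _ => radMeasure

/-- The randomized Hadamard transform `R_H x = (1/√d) H D x` where `D = diag ε`. -/
noncomputable def rhT {d : ℕ} (H : Matrix (Fin d) (Fin d) ℝ) (ε x : Fin d → ℝ) :
    Fin d → ℝ :=
  fun i => (1 / Real.sqrt d) * ∑ j, H i j * ε j * x j

/-- The sign `±1` encoded by a Boolean. -/
def boolSign (b : Bool) : ℝ := if b then 1 else -1

/-- The Boolean vector `b` with its `i`-th coordinate flipped. -/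
def flipAt {n : ℕ} (i : Fin n) (b : Fin n → Bool) : Fin n → Bool :=
  Function.update b i (!b i)

theorem flipAt_involutive {n : ℕ} (i : Fin n) : Function.Involutive (flipAt i) := by
  intro b
  simp [flipAt]

theorem compl_fun_involutive {n : ℕ} :
    Function.Involutive (fun (b : Fin n → Bool) j => !b j) := by
  intro b
  simp

theorem sum_comp_involutive {α : Type*} [Fintype α] {φ : α → α}
    (hφ : Function.Involutive φ) (g : α → ℝ) : ∑ b, g (φ b) = ∑ b, g b :=
  Equiv.sum_comp hφ.toPerm g

theorem sum_cube_succ {n : ℕ} (g : (Fin (n + 1) → Bool) → ℝ) :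
    ∑ b, g b = ∑ b : Fin n → Bool,
      (g (Fin.cons true b : Fin (n + 1) → Bool) + g (Fin.cons false b : Fin (n + 1) → Bool)) := by
  rw [← (Fin.consEquiv fun _ : Fin (n + 1) => Bool).sum_comp, Fintype.sum_prod_type,
    Fintype.sum_bool, ← Finset.sum_add_distrib]
  rfl

theorem flipAt_cons_zero {n : ℕ} (a : Bool) (b : Fin n → Bool) :
    flipAt 0 (Fin.cons a b : Fin (n + 1) → Bool) = (Fin.cons (!a) b : Fin (n + 1) → Bool) := by
  simp [flipAt, Fin.update_cons_zero]

theorem flipAt_cons_succ {n : ℕ} (a : Bool) (b : Fin n → Bool) (i : Fin n) :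
    flipAt i.succ (Fin.cons a b : Fin (n + 1) → Bool)
      = (Fin.cons a (flipAt i b) : Fin (n + 1) → Bool) := by
  simp [flipAt, Fin.cons_update]

theorem compl_cons {n : ℕ} (a : Bool) (b : Fin n → Bool) :
    (fun j => !(Fin.cons a b : Fin (n + 1) → Bool) j)
      = (Fin.cons (!a) (fun j => !b j) : Fin (n + 1) → Bool) := by
  funext j
  refine Fin.cases ?_ (fun k => ?_) j <;> simp

/-- The (unnormalized) Dirichlet energy of a function on the discrete cube. -/
def cubeEnergy {n : ℕ} (f : (Fin n → Bool) → ℝ) : ℝ :=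
  ∑ b, ∑ i, (f b - f (flipAt i b)) ^ 2

theorem cubeEnergy_succ {n : ℕ} (f : (Fin (n + 1) → Bool) → ℝ) (u v : (Fin n → Bool) → ℝ)
    (ht : ∀ b, f (Fin.cons true b : Fin (n + 1) → Bool) = u b + v b)
    (hf : ∀ b, f (Fin.cons false b : Fin (n + 1) → Bool) = u b - v b) :
    cubeEnergy f = 2 * cubeEnergy u + 2 * cubeEnergy v + 8 * ∑ b, v b ^ 2 := by
  unfold cubeEnergy
  rw [sum_cube_succ]
  simp only [Fin.sum_univ_succ, flipAt_cons_zero, flipAt_cons_succ, ht, hf, Bool.not_true,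
    Bool.not_false, Finset.mul_sum, ← Finset.sum_add_distrib]
  refine Finset.sum_congr rfl fun b _ => ?_
  rw [add_add_add_comm, ← Finset.sum_add_distrib, add_comm]
  congr 1
  · exact Finset.sum_congr rfl fun i _ => by ring
  · ring

/-- A Poincaré inequality on the discrete cube with the spectral gap `2` away from odd functions. -/
theorem poincare_cube {n : ℕ} (f : (Fin n → Bool) → ℝ) :
    8 * (∑ b, f b ^ 2 - (∑ b, f b) ^ 2 / 2 ^ n)
      ≤ cubeEnergy f + ∑ b, (f b - f (fun j => !b j)) ^ 2 := by
  induction n with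
  | zero =>
    have h : ∀ b : Fin 0 → Bool, (fun j => !b j) = b := fun b => Subsingleton.elim _ _
    simp [cubeEnergy, h]
  | succ n ih =>
    obtain ⟨u, hu⟩ : ∃ u : (Fin n → Bool) → ℝ, ∀ b, u b =
      (f (Fin.cons true b : Fin (n + 1) → Bool) + f (Fin.cons false b : Fin (n + 1) → Bool)) / 2 :=
      ⟨_, fun _ => rfl⟩
    obtain ⟨v, hv⟩ : ∃ v : (Fin n → Bool) → ℝ, ∀ b, v b =
      (f (Fin.cons true b : Fin (n + 1) → Bool) - f (Fin.cons false b : Fin (n + 1) → Bool)) / 2 :=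
      ⟨_, fun _ => rfl⟩
    have ht : ∀ b, f (Fin.cons true b : Fin (n + 1) → Bool) = u b + v b := fun b => by
      rw [hu, hv]; ring
    have hf : ∀ b, f (Fin.cons false b : Fin (n + 1) → Bool) = u b - v b := fun b => by
      rw [hu, hv]; ring
    have hsq : ∑ b, f b ^ 2 = 2 * ∑ b, u b ^ 2 + 2 * ∑ b, v b ^ 2 := by
      rw [sum_cube_succ]
      simp only [ht, hf, Finset.mul_sum, ← Finset.sum_add_distrib]
      exact Finset.sum_congr rfl fun b _ => by ring
    have hsum : ∑ b, f b = 2 * ∑ b, u b := by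
      rw [sum_cube_succ]
      simp only [ht, hf, Finset.mul_sum]
      exact Finset.sum_congr rfl fun b _ => by ring
    have hodd : ∑ b, (f b - f (fun j => !b j)) ^ 2
        = 2 * ∑ b, (u b - u (fun j => !b j)) ^ 2 + 2 * ∑ b, (v b + v (fun j => !b j)) ^ 2 := by
      rw [sum_cube_succ]
      simp only [compl_cons, Bool.not_true, Bool.not_false, ht, hf, Finset.mul_sum,
        ← Finset.sum_add_distrib]
      exact Finset.sum_congr rfl fun b _ => by ring
    have hpar : ∑ b, (v b - v (fun j => !b j)) ^ 2 + ∑ b, (v b + v (fun j => !b j)) ^ 2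
        = 4 * ∑ b, v b ^ 2 := by
      have h := sum_comp_involutive compl_fun_involutive (fun b : Fin n → Bool => v b ^ 2)
      have h' : ∑ b, (v b - v (fun j => !b j)) ^ 2 + ∑ b, (v b + v (fun j => !b j)) ^ 2
          = 2 * ∑ b, v b ^ 2 + 2 * ∑ b : Fin n → Bool, v (fun j => !b j) ^ 2 := by
        simp only [Finset.mul_sum, ← Finset.sum_add_distrib]
        exact Finset.sum_congr rfl fun b _ => by ring
      rw [h', h]
      ring
    have hcs : 4 * ((∑ b, v b) ^ 2 / 2 ^ n) ≤ ∑ b, (v b + v (fun j => !b j)) ^ 2 := by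
      have h := sq_sum_le_card_mul_sum_sq (s := Finset.univ)
        (f := fun b : Fin n → Bool => v b + v (fun j => !b j))
      rw [Finset.sum_add_distrib, sum_comp_involutive compl_fun_involutive v] at h
      simp only [Finset.card_univ, Fintype.card_pi, Fintype.card_bool, Finset.prod_const,
        Fintype.card_fin, Nat.cast_pow, Nat.cast_ofNat] at h
      rw [← mul_div_assoc, div_le_iff₀ (by positivity)]
      linarith
    have hdiv : (2 * ∑ b, u b) ^ 2 / 2 ^ (n + 1) = 2 * ((∑ b, u b) ^ 2 / 2 ^ n) := by
      field_simp
      ring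
    rw [cubeEnergy_succ f u v ht hf, hsq, hsum, hodd, hdiv]
    linarith [ih u, ih v]

theorem sum_sq_signed_sum {n : ℕ} (a : Fin n → ℝ) :
    ∑ b : Fin n → Bool, (∑ j, a j * boolSign (b j)) ^ 2 = 2 ^ n * ∑ j, a j ^ 2 := by
  induction n with
  | zero => simp
  | succ n ih =>
    rw [sum_cube_succ]
    simp only [Fin.sum_univ_succ, Fin.cons_zero, Fin.cons_succ]
    have h : ∀ S : ℝ, (a 0 * boolSign true + S) ^ 2 + (a 0 * boolSign false + S) ^ 2
        = 2 * a 0 ^ 2 + 2 * S ^ 2 := fun S => by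
      simp only [boolSign, if_true, Bool.false_eq_true, if_false]; ring
    simp only [h, Finset.sum_add_distrib, ← Finset.mul_sum, ih]
    simp
    ring

theorem signed_sum_flipAt {n : ℕ} (a : Fin n → ℝ) (b : Fin n → Bool) (i : Fin n) :
    ∑ j, a j * boolSign (flipAt i b j)
      = ∑ j, a j * boolSign (b j) - 2 * (a i * boolSign (b i)) := by
  have h : ∀ j, a j * boolSign (flipAt i b j)
      = a j * boolSign (b j) - if j = i then 2 * (a i * boolSign (b i)) else 0 := by
    intro j
    rcases eq_or_ne j i with rfl | hj
    · cases hb : b j <;> simp [flipAt, boolSign, hb] <;> ring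
    · simp [flipAt, hj]
  simp [h, Finset.sum_sub_distrib]

theorem cubeEnergy_abs_signed_sum_le {n : ℕ} (a : Fin n → ℝ) :
    cubeEnergy (fun b => |∑ j, a j * boolSign (b j)|)
      ≤ 4 * ∑ b : Fin n → Bool, |∑ j, a j * boolSign (b j)| ^ 2 := by
  obtain ⟨f, hf⟩ : ∃ f : (Fin n → Bool) → ℝ, f = fun b => |∑ j, a j * boolSign (b j)| := ⟨_, rfl⟩
  have hfb : ∀ b, |∑ j, a j * boolSign (b j)| = f b := fun b => by rw [hf]
  simp only [hfb]
  have henergy : cubeEnergy f = 2 * ∑ b, f b * ∑ i, (f b - f (flipAt i b)) := by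
    unfold cubeEnergy
    simp only [Finset.mul_sum]
    rw [Finset.sum_comm, Finset.sum_comm (s := Finset.univ (α := Fin n → Bool))]
    refine Finset.sum_congr rfl fun i _ => ?_
    have h := sum_comp_involutive (flipAt_involutive i) (fun b => f b ^ 2)
    have h' : ∑ b, (f b - f (flipAt i b)) ^ 2 - ∑ b, 2 * (f b * (f b - f (flipAt i b)))
        = ∑ b, f (flipAt i b) ^ 2 - ∑ b, f b ^ 2 := by
      simp only [← Finset.sum_sub_distrib]
      exact Finset.sum_congr rfl fun b _ => by ring
    linarith
  have hlap : ∀ b, ∑ i, (f b - f (flipAt i b)) ≤ 2 * f b := by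
    intro b
    have htri : ((n : ℝ) - 2) * f b ≤ ∑ i, f (flipAt i b) := by
      calc ((n : ℝ) - 2) * f b ≤ |(n : ℝ) - 2| * f b := by
            rw [hf]; exact mul_le_mul_of_nonneg_right (le_abs_self _) (abs_nonneg _)
        _ = |∑ i, ∑ j, a j * boolSign (flipAt i b j)| := by
            simp only [signed_sum_flipAt, Finset.sum_sub_distrib, ← Finset.mul_sum, hf]
            rw [← abs_mul]
            simp [sub_mul]
        _ ≤ ∑ i, f (flipAt i b) := by
            rw [hf]; exact Finset.abs_sum_le_sum_abs _ _
    simp only [Finset.sum_sub_distrib, Finset.sum_const, Finset.card_univ, Fintype.card_fin,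
      nsmul_eq_mul]
    linarith
  rw [henergy, Finset.mul_sum, Finset.mul_sum]
  refine Finset.sum_le_sum fun b _ => ?_
  have h0 : 0 ≤ f b := by rw [hf]; exact abs_nonneg _
  nlinarith [mul_le_mul_of_nonneg_left (hlap b) h0]

/-- The lower `L¹`–`L²` Khintchine inequality with the optimal constant `1/√2`. -/
theorem khintchine_lower {n : ℕ} (a : Fin n → ℝ) :
    √((∑ j, a j ^ 2) / 2)
      ≤ (2 ^ n)⁻¹ * ∑ b : Fin n → Bool, |∑ j, a j * boolSign (b j)| := by
  refine Real.sqrt_le_iff.2 ⟨by positivity, ?_⟩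
  have hp := poincare_cube (fun b : Fin n → Bool => |∑ j, a j * boolSign (b j)|)
  have he := cubeEnergy_abs_signed_sum_le a
  have hneg : ∀ b : Bool, boolSign (!b) = -boolSign b := by
    intro b; cases b <;> simp [boolSign]
  simp only [hneg, mul_neg, Finset.sum_neg_distrib, abs_neg, sub_self, ne_eq, OfNat.ofNat_ne_zero,
    not_false_eq_true, zero_pow, Finset.sum_const_zero, add_zero] at hp
  simp only [sq_abs, sum_sq_signed_sum] at hp he
  have hN : (0 : ℝ) < 2 ^ n := by positivity
  have key : 2 ^ n * ∑ j, a j ^ 2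
      ≤ 2 * ((∑ b : Fin n → Bool, |∑ j, a j * boolSign (b j)|) ^ 2 / 2 ^ n) := by linarith
  rw [← mul_div_assoc, le_div_iff₀ hN] at key
  rw [mul_pow, inv_pow, inv_mul_eq_div, le_div_iff₀ (by positivity)]
  nlinarith

/-- The upper `L¹`–`L²` Khintchine inequality. -/
theorem khintchine_upper {n : ℕ} (a : Fin n → ℝ) :
    (2 ^ n)⁻¹ * ∑ b : Fin n → Bool, |∑ j, a j * boolSign (b j)| ≤ √(∑ j, a j ^ 2) := by
  apply Real.le_sqrt_of_sq_le
  have h := sq_sum_le_card_mul_sum_sq (s := Finset.univ)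
    (f := fun b : Fin n → Bool => |∑ j, a j * boolSign (b j)|)
  simp only [sq_abs, sum_sq_signed_sum, Finset.card_univ, Fintype.card_pi, Fintype.card_bool,
    Finset.prod_const, Fintype.card_fin, Nat.cast_pow, Nat.cast_ofNat] at h
  rw [mul_pow, inv_pow, inv_mul_eq_div, div_le_iff₀ (by positivity)]
  linarith

/-- The uniform distribution on `Bool`. -/
noncomputable def boolMeasure : Measure Bool := (2 : ℝ≥0∞)⁻¹ • Measure.count

instance : IsProbabilityMeasure boolMeasure :=
  ⟨by rw [boolMeasure, Measure.smul_apply, Measure.count_univ]; simp [ENNReal.inv_mul_cancel]⟩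

theorem radMeasure_eq_map : radMeasure = boolMeasure.map boolSign := by
  ext s hs
  rw [Measure.map_apply (by fun_prop) hs]
  simp [radMeasure, boolMeasure, Measure.count, Measure.sum_fintype, hs,
    Set.indicator]
  rfl

theorem integral_radPi {d : ℕ} {g : (Fin d → ℝ) → ℝ} (hg : Continuous g) :
    ∫ ε, g ε ∂radPi d = (2 ^ d)⁻¹ * ∑ b : Fin d → Bool, g (fun j => boolSign (b j)) := by
  have hmap : radPi d
      = (Measure.pi fun _ : Fin d => boolMeasure).map (fun b j => boolSign (b j)) := by
    have : IsProbabilityMeasure (boolMeasure.map boolSign) :=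
      Measure.isProbabilityMeasure_map (by fun_prop)
    rw [radPi, radMeasure_eq_map, Measure.pi_map_pi (fun _ => by fun_prop)]
  rw [hmap, integral_map (Measurable.of_discrete.aemeasurable) hg.aestronglyMeasurable,
    integral_fintype (Integrable.of_finite), Finset.mul_sum]
  refine Finset.sum_congr rfl fun b _ => ?_
  rw [Measure.real, Measure.pi_singleton]
  simp [boolMeasure]

theorem hadamard_coordinate_khintchine (d : ℕ) (hd : 1 ≤ d)
    (H : Matrix (Fin d) (Fin d) ℝ)
    (hent : ∀ i j, H i j = 1 ∨ H i j = -1)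
    (hHHt : H * Hᵀ = (d : ℝ) • 1)
    (x : Fin d → ℝ) (i : Fin d) :
    (1 / Real.sqrt (2 * d)) * Real.sqrt (∑ j, (x j) ^ 2)
        ≤ ∫ ε, |rhT H ε x i| ∂radPi d ∧
    (∫ ε, |rhT H ε x i| ∂radPi d)
        ≤ (1 / Real.sqrt d) * Real.sqrt (∑ j, (x j) ^ 2) := by
  have hsq : ∑ j, (H i j * x j) ^ 2 = ∑ j, x j ^ 2 :=
    Finset.sum_congr rfl fun j _ => by rcases hent i j with h | h <;> simp [h]
  have hint : ∫ ε, |rhT H ε x i| ∂radPi d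
      = (1 / √d) * ((2 ^ d)⁻¹ * ∑ b : Fin d → Bool, |∑ j, H i j * x j * boolSign (b j)|) := by
    rw [← integral_radPi (g := fun ε => |∑ j, H i j * x j * ε j|) (by fun_prop),
      ← integral_const_mul]
    refine integral_congr_ae (Filter.Eventually.of_forall fun ε => ?_)
    simp only [rhT, abs_mul, abs_of_nonneg (show 0 ≤ 1 / √(d : ℝ) by positivity), mul_right_comm]
  rw [hint]
  constructor
  · have h := khintchine_lower (fun j => H i j * x j)
    rw [hsq] at h
    calc 1 / √(2 * d) * √(∑ j, x j ^ 2) = 1 / √d * √((∑ j, x j ^ 2) / 2) := by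
          rw [Real.sqrt_mul (by norm_num), Real.sqrt_div' _ (by norm_num)]
          ring
      _ ≤ _ := mul_le_mul_of_nonneg_left h (by positivity)
  · have h := khintchine_upper (fun j => H i j * x j)
    rw [hsq] at h
    exact mul_le_mul_of_nonneg_left h (by positivity)
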